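/- arXiv:2405.07393 — 3 statements merged into one kernel-verified Lean document; each statement's English description precedes it below -/
import Mathlib

section
/- Suppose α = ℙ(Y = 1) ≤ 1/2. Then for any measurable binary classifier f : 𝒳 → {0,1}, Acc(f) ≤ 1 − α + α · d_TV(P₀, P₁). -/
open MeasureTheory ProbabilityTheory

/-- Total variation distance between two measures: the supremum over measurable
sets `A` of `|P(A) - Q(A)|`. -/
noncomputable def dTV {𝒳 : Type*} [MeasurableSpace 𝒳] (P Q : Measure 𝒳) : ℝ :=
  ⨆ A : {A : Set 𝒳 // MeasurableSet A}, |(P A.1).toReal - (Q A.1).toReal|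

theorem abs_sub_le_dTV {𝒳 : Type*} [MeasurableSpace 𝒳] (P Q : Measure 𝒳)
    [IsProbabilityMeasure P] [IsProbabilityMeasure Q] {A : Set 𝒳} (hA : MeasurableSet A) :
    |P.real A - Q.real A| ≤ dTV P Q := by
  refine le_ciSup (f := fun A : {A : Set 𝒳 // MeasurableSet A} ↦
    |(P A.1).toReal - (Q A.1).toReal|) ⟨1, ?_⟩ ⟨A, hA⟩
  rintro _ ⟨B, rfl⟩
  change |P.real B.1 - Q.real B.1| ≤ 1
  rw [abs_le]
  constructor <;> linarith [measureReal_nonneg (μ := P) (s := B.1),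
    measureReal_nonneg (μ := Q) (s := B.1), measureReal_le_one (μ := P) (s := B.1),
    measureReal_le_one (μ := Q) (s := B.1)]

/-- The joint probability of an event and a value of `X` factors through the conditional law. -/
theorem measureReal_mul_map_cond {Ω 𝒳 : Type*} [MeasurableSpace Ω] [MeasurableSpace 𝒳]
    (μ : Measure Ω) [IsFiniteMeasure μ] {X : Ω → 𝒳} (hX : Measurable X)
    {S : Set Ω} (hS : MeasurableSet S) {A : Set 𝒳} (hA : MeasurableSet A) :
    μ.real S * ((μ[|S]).map X).real A = μ.real (S ∩ X ⁻¹' A) := by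
  rw [map_measureReal_apply hX hA, mul_comm, measureReal_def, measureReal_def,
    ← ENNReal.toReal_mul, cond_mul_eq_inter hS, measureReal_def]

/-- If `α ≤ 1/2`, then `Acc(f) ≤ 1 − α + α · d_TV(P₀, P₁)`. -/
theorem accuracy_upper_bound_alpha_le_half
    {Ω 𝒳 : Type*} [MeasurableSpace Ω] [MeasurableSpace 𝒳]
    (Pr : Measure Ω) [IsProbabilityMeasure Pr]
    (X : Ω → 𝒳) (hX : Measurable X)
    (Y : Ω → Bool) (hY : Measurable Y)
    (α : ℝ) (hα : α = (Pr {ω | Y ω = true}).toReal)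
    (hα0 : 0 < α) (hα1 : α < 1)
    (hhalf : α ≤ 1 / 2)
    (P₀ P₁ : Measure 𝒳)
    (hP₀ : P₀ = (Pr[|{ω | Y ω = false}]).map X)
    (hP₁ : P₁ = (Pr[|{ω | Y ω = true}]).map X)
    (f : 𝒳 → Bool) (hf : Measurable f)
    :
    (Pr {ω | f (X ω) = Y ω}).toReal ≤ 1 - α + α * dTV P₀ P₁ := by
  set T := {ω | Y ω = true}
  set F := {ω | Y ω = false}
  set A := f ⁻¹' {true}
  have hT : MeasurableSet T := hY (measurableSet_singleton true)
  have hF : MeasurableSet F := hY (measurableSet_singleton false)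
  have hA : MeasurableSet A := hf (measurableSet_singleton true)
  have hαT : Pr.real T = α := hα.symm
  have hFT : F = Tᶜ := by ext; simp [F, T]
  have hαF : Pr.real F = 1 - α := by rw [hFT, probReal_compl_eq_one_sub hT, hαT]
  have hT0 : Pr T ≠ 0 := fun h ↦ by simp [measureReal_def, h] at hαT; linarith
  have hF0 : Pr F ≠ 0 := fun h ↦ by simp [measureReal_def, h] at hαF; linarith
  have := cond_isProbabilityMeasure hT0
  have := cond_isProbabilityMeasure hF0
  have : IsProbabilityMeasure P₀ := hP₀ ▸ Measure.isProbabilityMeasure_map hX.aemeasurable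
  have : IsProbabilityMeasure P₁ := hP₁ ▸ Measure.isProbabilityMeasure_map hX.aemeasurable
  have hjointT : α * P₁.real A = Pr.real (T ∩ X ⁻¹' A) := by
    rw [← hαT, hP₁, measureReal_mul_map_cond Pr hX hT hA]
  have hjointF : (1 - α) * P₀.real A = Pr.real (F ∩ X ⁻¹' A) := by
    rw [← hαF, hP₀, measureReal_mul_map_cond Pr hX hF hA]
  have hsplit := measureReal_inter_add_sdiff (μ := Pr) (s := F) (hX hA)
  have hcorrect : {ω | f (X ω) = Y ω} = (T ∩ X ⁻¹' A) ∪ (F \ X ⁻¹' A) := by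
    ext ω
    cases hy : Y ω <;> simp [T, F, A, hy]
  have hacc : (Pr {ω | f (X ω) = Y ω}).toReal
      ≤ Pr.real (T ∩ X ⁻¹' A) + Pr.real (F \ X ⁻¹' A) :=
    hcorrect ▸ measureReal_union_le _ _
  have htv := (neg_le_abs _).trans (abs_sub_le_dTV P₀ P₁ hA)
  nlinarith [mul_le_mul_of_nonneg_left htv hα0.le,
    mul_nonneg (show 0 ≤ 1 - 2 * α by linarith) (measureReal_nonneg (μ := P₀) (s := A))]
end

section
/- Let f : 𝒳 → {0,1} be a measurable classifier with Δ_EO(f) ≤ ε_EO. Then Acc(f) ≤ max(α, 1 − α) + min(α, 1 − α) · d_TV(P₁ᵇ, P₀ᵇ) + β·ε_EO, where α = ℙ(Y = 1) and β = ℙ(Z = a). -/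
open MeasureTheory ProbabilityTheory

/-- Each event gap is at most the total variation distance. -/
theorem sub_le_dTV {𝒳 : Type*} [MeasurableSpace 𝒳] (P Q : Measure 𝒳)
    [IsProbabilityMeasure P] [IsProbabilityMeasure Q] {A : Set 𝒳} (hA : MeasurableSet A) :
    P.real A - Q.real A ≤ dTV P Q := by
  have hbdd : BddAbove (Set.range fun A : {A : Set 𝒳 // MeasurableSet A} =>
      |(P A.1).toReal - (Q A.1).toReal|) := by
    refine ⟨1, ?_⟩
    rintro _ ⟨B, rfl⟩
    change |P.real B.1 - Q.real B.1| ≤ 1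
    rw [abs_le]
    constructor <;> linarith [measureReal_nonneg (μ := P) (s := B.1),
      measureReal_nonneg (μ := Q) (s := B.1), measureReal_le_one (μ := P) (s := B.1),
      measureReal_le_one (μ := Q) (s := B.1)]
  exact (le_abs_self _).trans (le_ciSup hbdd ⟨A, hA⟩)

/-- Splitting an event along a binary variable. -/
theorem measureReal_eq_add_bool {Ω : Type*} [MeasurableSpace Ω] (μ : Measure Ω)
    [IsFiniteMeasure μ] {Z : Ω → Bool} (hZ : Measurable Z) (s : Set Ω) :
    μ.real s = μ.real (s ∩ {ω | Z ω = true}) + μ.real (s ∩ {ω | Z ω = false}) := by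
  have hZt : MeasurableSet {ω | Z ω = true} := hZ (measurableSet_singleton true)
  rw [← measureReal_inter_add_sdiff hZt]
  congr 2
  ext ω
  simp

/-- Accuracy bound for a randomized guess with true positive rate `t` and false positive rate `u`
under class prior `α`. -/
theorem weighted_accuracy_le {α t u d : ℝ} (hα₀ : 0 ≤ α) (hα₁ : α ≤ 1) (ht : t ≤ 1)
    (hu : 0 ≤ u) (hd : t - u ≤ d) :
    α * t + (1 - α) * (1 - u) ≤ max α (1 - α) + min α (1 - α) * d := by
  rcases le_total α (1 - α) with h | h
  · rw [max_eq_right h, min_eq_left h]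
    nlinarith [mul_nonneg hα₀ (sub_nonneg.2 hd), mul_nonneg (sub_nonneg.2 h) hu]
  · rw [max_eq_left h, min_eq_right h]
    nlinarith [mul_nonneg (sub_nonneg.2 hα₁) (sub_nonneg.2 hd),
      mul_nonneg (sub_nonneg.2 h) (sub_nonneg.2 ht)]

/-- For a classifier with `Δ_EO(f) ≤ ε_EO`:
`Acc(f) ≤ max(α, 1 − α) + min(α, 1 − α)·d_TV(P₁ᵇ, P₀ᵇ) + β·ε_EO`.
Here `Z = true` encodes group `a` and `Z = false` encodes group `b`. -/
theorem eo_accuracy_bound_subgroup_b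
    {Ω 𝒳 : Type*} [MeasurableSpace Ω] [MeasurableSpace 𝒳]
    (Pr : Measure Ω) [IsProbabilityMeasure Pr]
    (X : Ω → 𝒳) (hX : Measurable X)
    (Y Z : Ω → Bool) (hY : Measurable Y) (hZ : Measurable Z)
    (hpos : ∀ y z : Bool, 0 < Pr {ω | Y ω = y ∧ Z ω = z})
    (α β : ℝ)
    (hα : α = (Pr {ω | Y ω = true}).toReal)
    (hβ : β = (Pr {ω | Z ω = true}).toReal)
    (P₀b P₁b : Measure 𝒳)
    (hP₀b : P₀b = (Pr[|{ω | Y ω = false ∧ Z ω = false}]).map X)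
    (hP₁b : P₁b = (Pr[|{ω | Y ω = true ∧ Z ω = false}]).map X)
    (f : 𝒳 → Bool) (hf : Measurable f)
    (εEO : ℝ)
    (hEO : max
      |(Pr[|{ω | Z ω = true ∧ Y ω = true}] {ω | f (X ω) = true}).toReal -
        (Pr[|{ω | Z ω = false ∧ Y ω = true}] {ω | f (X ω) = true}).toReal|
      |(Pr[|{ω | Z ω = true ∧ Y ω = false}] {ω | f (X ω) = true}).toReal -
        (Pr[|{ω | Z ω = false ∧ Y ω = false}] {ω | f (X ω) = true}).toReal|
      ≤ εEO) :
    (Pr {ω | f (X ω) = Y ω}).toReal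
      ≤ max α (1 - α) + min α (1 - α) * dTV P₁b P₀b + β * εEO := by
  have hYm (y : Bool) : MeasurableSet {ω | Y ω = y} := hY (measurableSet_singleton y)
  have hZm (z : Bool) : MeasurableSet {ω | Z ω = z} := hZ (measurableSet_singleton z)
  have hS (y z : Bool) : MeasurableSet {ω | Y ω = y ∧ Z ω = z} := (hYm y).inter (hZm z)
  have hF : MeasurableSet {x | f x = true} := hf (measurableSet_singleton true)
  have hprob (y z : Bool) : IsProbabilityMeasure (Pr[|{ω | Y ω = y ∧ Z ω = z}]) :=
    cond_isProbabilityMeasure (hpos y z).ne'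
  have hcomm (y z : Bool) : {ω | Z ω = z ∧ Y ω = y} = {ω | Y ω = y ∧ Z ω = z} := by
    ext ω; exact and_comm
  simp only [hcomm, ← measureReal_def] at hEO hα hβ ⊢
  set p : Bool → Bool → ℝ := fun y z => Pr.real {ω | Y ω = y ∧ Z ω = z} with hp
  set t : Bool → Bool → ℝ := fun y z =>
    (Pr[|{ω | Y ω = y ∧ Z ω = z}]).real {ω | f (X ω) = true} with ht
  have hp₀ (y z : Bool) : 0 ≤ p y z := measureReal_nonneg
  have htp (y z : Bool) :
      Pr.real ({ω | Y ω = y ∧ Z ω = z} ∩ {ω | f (X ω) = true}) = p y z * t y z := by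
    simp only [hp, ht, measureReal_def]
    rw [← cond_mul_eq_inter (hS y z), ENNReal.toReal_mul, mul_comm]
  have htn (y z : Bool) :
      Pr.real ({ω | Y ω = y ∧ Z ω = z} ∩ {ω | f (X ω) = false}) = p y z * (1 - t y z) := by
    have h := measureReal_eq_add_bool Pr (hf.comp hX) {ω | Y ω = y ∧ Z ω = z}
    simp only [Function.comp_apply, htp] at h
    linarith
  have hαp : α = p true true + p true false := by
    rw [hα, measureReal_eq_add_bool Pr hZ]; rfl
  have hαn : Pr.real {ω | Y ω = false} = p false true + p false false := by
    rw [measureReal_eq_add_bool Pr hZ]; rfl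
  have hβp : β = p true true + p false true := by
    rw [hβ, measureReal_eq_add_bool Pr hY]
    simp only [Set.inter_comm {ω | Z ω = true}]
    rfl
  have htotal : α + Pr.real {ω | Y ω = false} = 1 := by
    have h := measureReal_eq_add_bool Pr hY Set.univ
    simp only [Set.univ_inter, probReal_univ] at h
    linarith
  have hacc : Pr.real {ω | f (X ω) = Y ω} =
      p true true * t true true + p true false * t true false
        + p false true * (1 - t false true) + p false false * (1 - t false false) := by
    rw [measureReal_eq_add_bool Pr hY,
      measureReal_eq_add_bool Pr hZ ({ω | f (X ω) = Y ω} ∩ {ω | Y ω = true}),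
      measureReal_eq_add_bool Pr hZ ({ω | f (X ω) = Y ω} ∩ {ω | Y ω = false}),
      ← htp, ← htp, ← htn, ← htn, ← add_assoc]
    refine congrArg₂ _ (congrArg₂ _ (congrArg₂ _ ?_ ?_) ?_) ?_ <;>
      refine congrArg _ (Set.ext fun ω => ?_) <;>
      simp only [Set.mem_inter_iff, Set.mem_ofPred_eq] <;> grind
  have hd : t true false - t false false ≤ dTV P₁b P₀b := by
    have h₀ : IsProbabilityMeasure P₀b :=
      hP₀b ▸ Measure.isProbabilityMeasure_map hX.aemeasurable
    have h₁ : IsProbabilityMeasure P₁b :=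
      hP₁b ▸ Measure.isProbabilityMeasure_map hX.aemeasurable
    have h := sub_le_dTV P₁b P₀b hF
    have e₁ : P₁b.real {x | f x = true} = t true false := by
      rw [hP₁b, map_measureReal_apply hX hF]; rfl
    have e₀ : P₀b.real {x | f x = true} = t false false := by
      rw [hP₀b, map_measureReal_apply hX hF]; rfl
    rwa [e₁, e₀] at h
  have hpos_gap : t true true - t true false ≤ εEO :=
    (le_abs_self _).trans ((le_max_left _ _).trans hEO)
  have hneg_gap : t false false - t false true ≤ εEO := by
    rw [← neg_sub]
    exact (neg_le_abs _).trans ((le_max_right _ _).trans hEO)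
  have hbound := weighted_accuracy_le (α := α) (by linarith [hp₀ true true, hp₀ true false])
    (by linarith [hp₀ false true, hp₀ false false])
    (measureReal_le_one : t true false ≤ 1) (measureReal_nonneg : 0 ≤ t false false) hd
  rw [hacc]
  have hα' : 1 - α = p false true + p false false := by linarith
  have hsplit : α * t true false + (1 - α) * (1 - t false false) =
      (p true true + p true false) * t true false
        + (p false true + p false false) * (1 - t false false) := by rw [hα', hαp]
  have hβε : β * εEO = p true true * εEO + p false true * εEO := by rw [hβp]; ring
  linarith [mul_le_mul_of_nonneg_left hpos_gap (hp₀ true true),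
    mul_le_mul_of_nonneg_left hneg_gap (hp₀ false true)]
end

section
/- Let f : 𝒳 → {0,1} be a measurable classifier with Δ_EO(f) ≤ ε_EO. Then Acc(f) ≤ max(α, 1 − α) + min(α, 1 − α) · d_TV(P₁ᵃ, P₀ᵃ) + (1 − β)·ε_EO, where α = ℙ(Y = 1) and β = ℙ(Z = a). -/
open MeasureTheory ProbabilityTheory

theorem abs_toReal_sub_le_dTV {𝒳 : Type*} [MeasurableSpace 𝒳] (P Q : Measure 𝒳)
    [IsProbabilityMeasure P] [IsProbabilityMeasure Q] {A : Set 𝒳} (hA : MeasurableSet A) :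
    |(P A).toReal - (Q A).toReal| ≤ dTV P Q := by
  refine le_ciSup (f := fun A : {A : Set 𝒳 // MeasurableSet A} ↦
    |(P A.1).toReal - (Q A.1).toReal|) ⟨1, ?_⟩ ⟨A, hA⟩
  rintro _ ⟨B, rfl⟩
  exact abs_sub_le_of_nonneg_of_le measureReal_nonneg measureReal_le_one
    measureReal_nonneg measureReal_le_one

theorem measureReal_eq_add_fibers_bool {Ω : Type*} [MeasurableSpace Ω] (μ : Measure Ω)
    [IsFiniteMeasure μ] {Y : Ω → Bool} (hY : Measurable Y) (E : Set Ω) :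
    μ.real E = μ.real (E ∩ {ω | Y ω = true}) + μ.real (E ∩ {ω | Y ω = false}) := by
  rw [← measureReal_inter_add_sdiff (μ := μ) (s := E) (hY (measurableSet_singleton true))]
  congr 2
  ext ω
  simp

theorem accuracy_mixture_le {α p q d : ℝ} (hα₀ : 0 ≤ α) (hα₁ : α ≤ 1) (hp : p ≤ 1)
    (hq : 0 ≤ q) (hd : p - q ≤ d) :
    α * p + (1 - α) * (1 - q) ≤ max α (1 - α) + min α (1 - α) * d := by
  rcases le_total α (1 - α) with h | h
  · rw [max_eq_right h, min_eq_left h]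
    nlinarith
  · rw [max_eq_left h, min_eq_right h]
    nlinarith

/-- For a classifier with `Δ_EO(f) ≤ ε_EO`:
`Acc(f) ≤ max(α, 1 − α) + min(α, 1 − α)·d_TV(P₁ᵃ, P₀ᵃ) + (1 − β)·ε_EO`.
Here `Z = true` encodes group `a` and `Z = false` encodes group `b`. -/
theorem eo_accuracy_bound_subgroup_a
    {Ω 𝒳 : Type*} [MeasurableSpace Ω] [MeasurableSpace 𝒳]
    (Pr : Measure Ω) [IsProbabilityMeasure Pr]
    (X : Ω → 𝒳) (hX : Measurable X)
    (Y Z : Ω → Bool) (hY : Measurable Y) (hZ : Measurable Z)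
    (hpos : ∀ y z : Bool, 0 < Pr {ω | Y ω = y ∧ Z ω = z})
    (α β : ℝ)
    (hα : α = (Pr {ω | Y ω = true}).toReal)
    (hβ : β = (Pr {ω | Z ω = true}).toReal)
    (P₀a P₁a : Measure 𝒳)
    (hP₀a : P₀a = (Pr[|{ω | Y ω = false ∧ Z ω = true}]).map X)
    (hP₁a : P₁a = (Pr[|{ω | Y ω = true ∧ Z ω = true}]).map X)
    (f : 𝒳 → Bool) (hf : Measurable f)
    (εEO : ℝ)
    (hEO : max
      |(Pr[|{ω | Z ω = true ∧ Y ω = true}] {ω | f (X ω) = true}).toReal -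
        (Pr[|{ω | Z ω = false ∧ Y ω = true}] {ω | f (X ω) = true}).toReal|
      |(Pr[|{ω | Z ω = true ∧ Y ω = false}] {ω | f (X ω) = true}).toReal -
        (Pr[|{ω | Z ω = false ∧ Y ω = false}] {ω | f (X ω) = true}).toReal|
      ≤ εEO) :
    (Pr {ω | f (X ω) = Y ω}).toReal
      ≤ max α (1 - α) + min α (1 - α) * dTV P₁a P₀a + (1 - β) * εEO := by
  have hYm (y : Bool) : MeasurableSet {ω | Y ω = y} := hY (measurableSet_singleton y)
  have hZm (z : Bool) : MeasurableSet {ω | Z ω = z} := hZ (measurableSet_singleton z)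
  have hF : MeasurableSet {x | f x = true} := hf (measurableSet_singleton true)
  have hFX : MeasurableSet {ω | f (X ω) = true} := hX hF
  have hswap (y z : Bool) : {ω | Z ω = z ∧ Y ω = y} = {ω | Y ω = y ∧ Z ω = z} :=
    Set.ext fun _ ↦ and_comm
  simp only [hswap] at hEO
  have hprob (y z : Bool) : IsProbabilityMeasure Pr[|{ω | Y ω = y ∧ Z ω = z}] :=
    cond_isProbabilityMeasure (hpos y z).ne'
  set w : Bool → Bool → ℝ := fun y z ↦ Pr.real {ω | Y ω = y ∧ Z ω = z} with hw
  set p : Bool → Bool → ℝ :=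
    fun y z ↦ (Pr[|{ω | Y ω = y ∧ Z ω = z}]).real {ω | f (X ω) = true} with hp
  have hwp (y z : Bool) :
      w y z * p y z = Pr.real ({ω | Y ω = y ∧ Z ω = z} ∩ {ω | f (X ω) = true}) := by
    have hne : w y z ≠ 0 := (ENNReal.toReal_pos (hpos y z).ne' (measure_ne_top _ _)).ne'
    have hm : MeasurableSet {ω | Y ω = y ∧ Z ω = z} := (hYm y).inter (hZm z)
    simp only [hp, measureReal_def, cond_apply hm, ENNReal.toReal_mul, ENNReal.toReal_inv]
    exact mul_inv_cancel_left₀ hne _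
  have hwq (y z : Bool) : w y z * (1 - p y z) =
      Pr.real ({ω | Y ω = y ∧ Z ω = z} ∩ {ω | f (X ω) = false}) := by
    have hsplit := measureReal_eq_add_fibers_bool Pr (hf.comp hX) {ω | Y ω = y ∧ Z ω = z}
    simp only [Function.comp_apply] at hsplit
    linarith [hwp y z]
  have hw₀ (y z : Bool) : 0 ≤ w y z := measureReal_nonneg
  have hαw : α = w true true + w true false := by
    rw [hα]
    exact measureReal_eq_add_fibers_bool Pr hZ _
  have hβw : β = w true true + w false true := by
    rw [hβ]
    refine (measureReal_eq_add_fibers_bool Pr hY _).trans ?_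
    simp only [hw, ← hswap]
    rfl
  have hone : 1 = w true true + w true false + (w false true + w false false) := by
    rw [← probReal_univ (μ := Pr), measureReal_eq_add_fibers_bool Pr hY,
      measureReal_eq_add_fibers_bool Pr hZ (_ ∩ {ω | Y ω = true}),
      measureReal_eq_add_fibers_bool Pr hZ (_ ∩ {ω | Y ω = false})]
    simp only [Set.univ_inter]
    rfl
  have hacc : (Pr {ω | f (X ω) = Y ω}).toReal =
      w true true * p true true + w true false * p true false +
      (w false true * (1 - p false true) + w false false * (1 - p false false)) := by
    rw [hwp, hwp, hwq, hwq, ← measureReal_def, measureReal_eq_add_fibers_bool Pr hY,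
      measureReal_eq_add_fibers_bool Pr hZ (_ ∩ {ω | Y ω = true}),
      measureReal_eq_add_fibers_bool Pr hZ (_ ∩ {ω | Y ω = false})]
    congr 3 <;> ext ω <;> simp only [Set.mem_inter_iff, Set.mem_ofPred_eq] <;> grind
  have hTV : p true true - p false true ≤ dTV P₁a P₀a := by
    have : IsProbabilityMeasure P₁a := hP₁a ▸ Measure.isProbabilityMeasure_map hX.aemeasurable
    have : IsProbabilityMeasure P₀a := hP₀a ▸ Measure.isProbabilityMeasure_map hX.aemeasurable
    have h := (le_abs_self _).trans (abs_toReal_sub_le_dTV P₁a P₀a hF)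
    rw [hP₁a, hP₀a, Measure.map_apply hX hF, Measure.map_apply hX hF, ← hP₁a, ← hP₀a] at h
    exact h
  have hEO₁ : p true false ≤ p true true + εEO := by
    have h := (neg_le_abs _).trans ((le_max_left _ _).trans hEO)
    simp only [hp, measureReal_def]
    linarith
  have hEO₀ : p false true - εEO ≤ p false false := by
    have h := (le_abs_self _).trans ((le_max_right _ _).trans hEO)
    simp only [hp, measureReal_def]
    linarith
  have hmix := accuracy_mixture_le (α := α) (p := p true true) (q := p false true)
    (by linarith [hw₀ true true, hw₀ true false])
    (by linarith [hw₀ false true, hw₀ false false]) measureReal_le_one measureReal_nonneg hTV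
  have hb₁ := mul_le_mul_of_nonneg_left hEO₁ (hw₀ true false)
  have hb₀ := mul_le_mul_of_nonneg_left hEO₀ (hw₀ false false)
  have hα' : 1 - α = w false true + w false false := by linarith
  have hβ' : 1 - β = w true false + w false false := by linarith
  rw [hacc]
  refine le_trans ?_ (add_le_add_left hmix _)
  rw [hα', hβ', hαw]
  linarith
end
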